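/- Let k ≥ 1, let 0 < δ < 1 with δ + 1/k < 1, and let 1 ≤ i ≤ k. Suppose the edges of the rooted D-ary tree T_D^k are given i.i.d. labels uniform on [0,1]. Call a root-to-leaf path, with consecutive edge labels (X_1,…,X_k) read from the root, 'good' if X_1 ≤ ⋯ ≤ X_k, 1 − δ − 1/k ≤ X_k ≤ 1 − δ, and X_j ≥ (j/k)·X_k for every 1 ≤ j ≤ k. Then for any two root-to-leaf paths whose common initial segment consists of exactly the first k − i edges, the conditional probability that the second path is good given that the first path is good is at most e^{1/(1−δ)}·(1/i!)·(i·(1−δ)/k)^i, which is at most e^{1/(1−δ)}·(e·(1−δ)/k)^i. -/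

import Mathlib

open MeasureTheory Filter Topology
open scoped ENNReal

/-- The edge set of the rooted `D`-ary tree `T_D^k` with `k` levels: an edge is identified
with its endpoint farther from the root, i.e. with a vertex at some level `i+1`
(`0 ≤ i < k`), which is a sequence of `i+1` child-choices in `Fin D`. -/
abbrev TreeEdge (D k : ℕ) : Type := (i : Fin k) × (Fin (i.1 + 1) → Fin D)

/-- A leaf of `T_D^k` is a sequence `x : Fin k → Fin D` of child-choices; `edgeOfLeaf D k x i`
is the `i`-th edge (counted from the root) on the unique path from the root to the leaf `x`. -/
def edgeOfLeaf (D k : ℕ) (x : Fin k → Fin D) (i : Fin k) : TreeEdge D k :=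
  ⟨i, fun t => x ⟨t.1, lt_of_lt_of_le t.isLt i.isLt⟩⟩

/-- The product of uniform measures on `[0,1]`, one coordinate for each element of `ι`:
i.i.d. uniform `[0,1]` random labels. -/
noncomputable def cubeMeasure (ι : Type) [Fintype ι] : Measure (ι → ℝ) :=
  Measure.pi fun _ => volume.restrict (Set.Icc (0:ℝ) 1)

/-- The root-to-leaf path to the leaf `x` is *good* for the labeling `ℓ` if its labels
`(X_1,…,X_k)` (read from the root) satisfy `X_1 ≤ ⋯ ≤ X_k`, `1−δ−1/k ≤ X_k ≤ 1−δ`, and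
`X_j ≥ (j/k)·X_k` for every `1 ≤ j ≤ k`. -/
def IsGoodPath (D k : ℕ) (hk : 1 ≤ k) (δ : ℝ) (ℓ : TreeEdge D k → ℝ)
    (x : Fin k → Fin D) : Prop :=
  (∀ i j : Fin k, i ≤ j → ℓ (edgeOfLeaf D k x i) ≤ ℓ (edgeOfLeaf D k x j)) ∧
  (1 - δ - 1 / (k : ℝ) ≤ ℓ (edgeOfLeaf D k x ⟨k - 1, Nat.sub_lt hk Nat.one_pos⟩)) ∧
  (ℓ (edgeOfLeaf D k x ⟨k - 1, Nat.sub_lt hk Nat.one_pos⟩) ≤ 1 - δ) ∧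
  (∀ j : Fin k, ((j.1 + 1 : ℝ) / (k : ℝ)) *
      ℓ (edgeOfLeaf D k x ⟨k - 1, Nat.sub_lt hk Nat.one_pos⟩) ≤ ℓ (edgeOfLeaf D k x j))

instance (ι : Type) [Fintype ι] : IsProbabilityMeasure (cubeMeasure ι) := by
  have : IsProbabilityMeasure (volume.restrict (Set.Icc (0:ℝ) 1)) := ⟨by simp⟩
  unfold cubeMeasure
  infer_instance

theorem iIndepFun_cubeMeasure {ι : Type} [Fintype ι] :
    ProbabilityTheory.iIndepFun (fun (e : ι) (ℓ : ι → ℝ) => ℓ e) (cubeMeasure ι) := by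
  have : IsProbabilityMeasure (volume.restrict (Set.Icc (0:ℝ) 1)) := ⟨by simp⟩
  exact ProbabilityTheory.iIndepFun_pi (X := fun _ : ι => id) fun _ => aemeasurable_id

/-- Coordinates of the cube indexed by an injective family are again i.i.d. uniform. -/
theorem map_cubeMeasure_comp {ι κ : Type} [Fintype ι] [Fintype κ] {f : κ → ι}
    (hf : Function.Injective f) :
    (cubeMeasure ι).map (fun ℓ t => ℓ (f t)) = cubeMeasure κ := by
  have : IsProbabilityMeasure (volume.restrict (Set.Icc (0:ℝ) 1)) := ⟨by simp⟩
  rw [(ProbabilityTheory.iIndepFun_iff_map_fun_eq_pi_map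
    (fun t => (measurable_pi_apply (f t)).aemeasurable)).1 (iIndepFun_cubeMeasure.precomp hf)]
  unfold cubeMeasure
  congr 1
  funext t
  exact (measurePreserving_eval (fun _ : ι => volume.restrict (Set.Icc (0:ℝ) 1)) (f t)).map_eq

theorem cubeMeasure_le_volume (ι : Type) [Fintype ι] (s : Set (ι → ℝ)) :
    cubeMeasure ι s ≤ volume s := by
  have h : cubeMeasure ι = (volume : Measure (ι → ℝ)).restrict
      (Set.univ.pi fun _ => Set.Icc (0:ℝ) 1) := by
    rw [volume_pi, Measure.restrict_pi_pi]
    rfl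
  rw [h]
  exact Measure.restrict_apply_le _ _

/-- The set of nondecreasing `n`-tuples with entries in `[a, b]`. -/
def monotoneTuples (n : ℕ) (a b : ℝ) : Set (Fin n → ℝ) :=
  {v | Monotone v} ∩ Set.Icc (fun _ => a) (fun _ => b)

theorem measurableSet_monotoneTuples (n : ℕ) (a b : ℝ) :
    MeasurableSet (monotoneTuples n a b) := by
  have h : IsClosed {v : Fin n → ℝ | Monotone v} := isClosed_monotone
  exact h.measurableSet.inter measurableSet_Icc

theorem volume_eq_coordinates {n : ℕ} {p q : Fin n} (hpq : p ≠ q) :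
    volume {v : Fin n → ℝ | v p = v q} = 0 := by
  let L : (Fin n → ℝ) →ₗ[ℝ] ℝ :=
    LinearMap.proj (R := ℝ) (φ := fun _ => ℝ) p - LinearMap.proj (R := ℝ) (φ := fun _ => ℝ) q
  have h : {v : Fin n → ℝ | v p = v q} = (LinearMap.ker L : Set (Fin n → ℝ)) := by
    ext v
    simp [L, sub_eq_zero]
  rw [h]
  refine Measure.addHaar_submodule _ _ fun htop => ?_
  have hmem : (Pi.single p 1 : Fin n → ℝ) ∈ LinearMap.ker L := htop ▸ Submodule.mem_top
  simp [L, hpq.symm] at hmem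

/-- The simplex of nondecreasing tuples occupies at most a fraction `1 / n!` of the cube. -/
theorem volume_monotoneTuples_le (n : ℕ) (a b : ℝ) :
    volume (monotoneTuples n a b) ≤ ENNReal.ofReal (b - a) ^ n / (n.factorial : ℝ≥0∞) := by
  classical
  let S : Equiv.Perm (Fin n) → Set (Fin n → ℝ) := fun σ =>
    (fun v => v ∘ σ) ⁻¹' monotoneTuples n a b
  have hvol (σ : Equiv.Perm (Fin n)) : volume (S σ) = volume (monotoneTuples n a b) := by
    have hmp : MeasurePreserving (fun v : Fin n → ℝ => v ∘ σ) volume volume :=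
      volume_preserving_arrowCongr' σ.symm (MeasurableEquiv.refl ℝ) (.id _)
    exact hmp.measure_preimage (measurableSet_monotoneTuples n a b).nullMeasurableSet
  have hmeas (σ : Equiv.Perm (Fin n)) : MeasurableSet (S σ) :=
    (measurable_pi_lambda _ fun t => measurable_pi_apply (σ t))
      (measurableSet_monotoneTuples n a b)
  have hdisj (σ τ : Equiv.Perm (Fin n)) (hne : σ ≠ τ) : AEDisjoint volume (S σ) (S τ) := by
    obtain ⟨t, ht⟩ := DFunLike.ne_iff.1 hne
    refine measure_mono_null ?_ (volume_eq_coordinates ht)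
    rintro v ⟨hσ, hτ⟩
    exact congrFun (Tuple.unique_monotone hσ.1 hτ.1) t
  have hsub : (⋃ σ ∈ (Finset.univ : Finset (Equiv.Perm (Fin n))), S σ) ⊆
      Set.Icc (fun _ => a) (fun _ => b) := by
    refine Set.iUnion₂_subset fun σ _ v hv => ⟨fun t => ?_, fun t => ?_⟩
    · simpa using hv.2.1 (σ.symm t)
    · simpa using hv.2.2 (σ.symm t)
  have hle := measure_mono (μ := volume) hsub
  rw [measure_biUnion_finset₀ (fun σ _ τ _ hne => hdisj σ τ hne)
    (fun σ _ => (hmeas σ).nullMeasurableSet), Real.volume_Icc_pi] at hle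
  simp only [hvol, Finset.sum_const, Finset.card_univ, Fintype.card_perm, Fintype.card_fin,
    Finset.prod_const, nsmul_eq_mul] at hle
  rw [ENNReal.le_div_iff_mul_le (by simp [Nat.factorial_ne_zero]) (by simp), mul_comm]
  exact hle

theorem edgeOfLeaf_injective (D k : ℕ) (x : Fin k → Fin D) :
    Function.Injective (edgeOfLeaf D k x) := fun _ _ h => congrArg Sigma.fst h

/-- If two paths share their `m`-th edge, they share every earlier edge. -/
theorem edgeOfLeaf_eq_of_le {D k : ℕ} {x y : Fin k → Fin D} {j m : Fin k} (hjm : j ≤ m)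
    (h : edgeOfLeaf D k x m = edgeOfLeaf D k y m) :
    edgeOfLeaf D k x j = edgeOfLeaf D k y j := by
  have h' := eq_of_heq (Sigma.mk.inj h).2
  refine Sigma.ext rfl (heq_of_eq (funext fun t => ?_))
  exact congrFun h' ⟨t.1, lt_of_lt_of_le t.isLt (Nat.succ_le_succ hjm)⟩

/-- The event that a path is good depends measurably on the labels along the path. -/
theorem exists_measurableSet_isGoodPath (D k : ℕ) (hk : 1 ≤ k) (δ : ℝ) (x : Fin k → Fin D) :
    ∃ A : Set (Fin k → ℝ), MeasurableSet A ∧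
      {ℓ | IsGoodPath D k hk δ ℓ x} = (fun ℓ j => ℓ (edgeOfLeaf D k x j)) ⁻¹' A := by
  let l : Fin k := ⟨k - 1, Nat.sub_lt hk Nat.one_pos⟩
  refine ⟨{v | Monotone v} ∩ ({v | 1 - δ - 1 / (k : ℝ) ≤ v l} ∩ ({v | v l ≤ 1 - δ} ∩
    {v | ∀ j : Fin k, ((j.1 + 1 : ℝ) / (k : ℝ)) * v l ≤ v j})), ?_, rfl⟩
  refine IsClosed.measurableSet ?_
  refine isClosed_monotone.inter (IsClosed.inter ?_ (IsClosed.inter ?_ ?_))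
  · exact isClosed_le continuous_const (continuous_apply l)
  · exact isClosed_le (continuous_apply l) continuous_const
  · rw [Set.ofPred_forall]
    exact isClosed_iInter fun j =>
      isClosed_le (continuous_const.mul (continuous_apply l)) (continuous_apply j)

/-- The last `i` labels of a good path form a nondecreasing tuple in a short interval. -/
theorem IsGoodPath.tail_mem_monotoneTuples {D k : ℕ} {hk : 1 ≤ k} {δ : ℝ}
    {ℓ : TreeEdge D k → ℝ} {y : Fin k → Fin D} (h : IsGoodPath D k hk δ ℓ y)
    {i : ℕ} (hi1 : 1 ≤ i) (hik : i ≤ k) :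
    (fun t : Fin i => ℓ (edgeOfLeaf D k y ⟨k - i + t, by omega⟩)) ∈
      monotoneTuples i (((k - i : ℝ) + 1) / k * (1 - δ - 1 / k)) (1 - δ) := by
  obtain ⟨hmono, hlo, hhi, hj⟩ := h
  have hk0 : (0 : ℝ) < k := by exact_mod_cast hk
  have hik' : (i : ℝ) ≤ k := by exact_mod_cast hik
  refine ⟨fun s t hst => hmono _ _ (Nat.add_le_add_left hst _), fun t => ?_, fun t => ?_⟩
  · refine le_trans ?_ (hmono ⟨k - i, by omega⟩ _ (Nat.le_add_right _ _))
    refine le_trans (mul_le_mul_of_nonneg_left hlo (div_nonneg (by linarith) hk0.le)) ?_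
    have := hj ⟨k - i, by omega⟩
    simpa only [Nat.cast_sub hik] using this
  · exact (hmono _ _ (show k - i + t.1 ≤ k - 1 by omega)).trans hhi

/-- The numerical estimate behind the bound on the conditional probability. -/
theorem interval_length_pow_le {k i : ℕ} {δ : ℝ} (hi1 : 1 ≤ i) (hik : i ≤ k)
    (hδ1 : δ < 1) (hδk : δ + 1 / (k : ℝ) < 1) :
    ((1 - δ) - ((k - i : ℝ) + 1) / k * (1 - δ - 1 / k)) ^ i ≤
      Real.exp (1 / (1 - δ)) * ((i * (1 - δ)) / k) ^ i := by
  have hi0 : (0 : ℝ) < i := by exact_mod_cast hi1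
  have hi1' : (1 : ℝ) ≤ i := by exact_mod_cast hi1
  have hik' : (i : ℝ) ≤ k := by exact_mod_cast hik
  have hk0 : (0 : ℝ) < k := hi0.trans_le hik'
  have hd : 0 < 1 - δ := by linarith
  have hexp : Real.exp (1 / (1 - δ)) = Real.exp (1 / (i * (1 - δ))) ^ i := by
    rw [← Real.exp_nat_mul]
    congr 1
    field_simp
  have hlen : (1 - δ) - ((k - i : ℝ) + 1) / k * (1 - δ - 1 / k) ≤
      (1 / (i * (1 - δ)) + 1) * ((i * (1 - δ)) / k) := by
    have e1 : (1 - δ) - ((k - i : ℝ) + 1) / k * (1 - δ - 1 / k) =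
        (i - 1) * (1 - δ) / k + (1 - (i - 1) / k) / k := by
      field_simp
      ring
    have e2 : (1 / (i * (1 - δ)) + 1) * ((i * (1 - δ)) / k) = 1 / k + i * (1 - δ) / k := by
      field_simp
    rw [e1, e2, add_comm]
    have : 0 ≤ (i - 1 : ℝ) / k := div_nonneg (by linarith) hk0.le
    gcongr <;> linarith
  have hnonneg : 0 ≤ (1 - δ) - ((k - i : ℝ) + 1) / k * (1 - δ - 1 / k) := by
    have h1 : ((k - i : ℝ) + 1) / k ≤ 1 := (div_le_one hk0).2 (by linarith)
    have h2 : 0 < 1 / (k : ℝ) := by positivity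
    have h3 : 0 ≤ 1 - δ - 1 / (k : ℝ) := by linarith
    nlinarith [mul_le_mul_of_nonneg_right h1 h3]
  rw [hexp, ← mul_pow]
  refine pow_le_pow_left₀ hnonneg (hlen.trans ?_) i
  gcongr
  exact Real.add_one_le_exp _

theorem one_div_factorial_mul_pow_le (i : ℕ) {c : ℝ} (hc : 0 ≤ c) :
    1 / (i.factorial : ℝ) * (i * c) ^ i ≤ (Real.exp 1 * c) ^ i := by
  have h := Real.pow_div_factorial_le_exp (i : ℝ) i.cast_nonneg i
  rw [mul_pow, mul_pow, ← Real.exp_nat_mul, mul_one, ← mul_assoc, one_div_mul_eq_div]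
  gcongr

/-- Labels read along two families of edges with no edge in common are independent. -/
theorem indepFun_cubeMeasure_comp {ι κ₁ κ₂ : Type} [Fintype ι] [Fintype κ₁] [Fintype κ₂]
    {f : κ₁ → ι} {g : κ₂ → ι} (hfg : ∀ s t, f s ≠ g t) :
    ProbabilityTheory.IndepFun (fun ℓ t => ℓ (f t)) (fun ℓ t => ℓ (g t)) (cubeMeasure ι) := by
  classical
  have hdisj : Disjoint (Finset.univ.image f) (Finset.univ.image g) := by
    simp only [Finset.disjoint_left, Finset.mem_image, Finset.mem_univ, true_and]
    rintro _ ⟨s, rfl⟩ ⟨t, ht⟩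
    exact hfg s t ht.symm
  have h := iIndepFun_cubeMeasure.indepFun_finset _ _ hdisj (fun e : ι => measurable_pi_apply e)
  exact h.comp
    (φ := fun v t => v ⟨f t, Finset.mem_image_of_mem f (Finset.mem_univ t)⟩)
    (ψ := fun v t => v ⟨g t, Finset.mem_image_of_mem g (Finset.mem_univ t)⟩)
    (measurable_pi_lambda _ fun _ => measurable_pi_apply _)
    (measurable_pi_lambda _ fun _ => measurable_pi_apply _)

/-- for two root-to-leaf paths of `T_D^k` whose common initial segment
consists of exactly the first `k − i` edges, under i.i.d. uniform `[0,1]` edge labels, the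
conditional probability that the second path is good given that the first one is good is at
most `e^{1/(1−δ)}·(1/i!)·(i(1−δ)/k)^i ≤ e^{1/(1−δ)}·(e(1−δ)/k)^i`. -/
theorem conditional_probability_second_path_good
    (D k : ℕ) (hk : 1 ≤ k) (δ : ℝ) (hδ0 : 0 < δ) (hδ1 : δ < 1)
    (hδk : δ + 1 / (k : ℝ) < 1)
    (i : ℕ) (hi1 : 1 ≤ i) (hik : i ≤ k)
    (x y : Fin k → Fin D)
    (hshare : ∀ j : Fin k, (j : ℕ) < k - i → edgeOfLeaf D k x j = edgeOfLeaf D k y j)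
    (hdiff : edgeOfLeaf D k x ⟨k - i, by omega⟩ ≠ edgeOfLeaf D k y ⟨k - i, by omega⟩) :
    (cubeMeasure (TreeEdge D k)
        ({ℓ | IsGoodPath D k hk δ ℓ y} ∩ {ℓ | IsGoodPath D k hk δ ℓ x}) /
      cubeMeasure (TreeEdge D k) {ℓ | IsGoodPath D k hk δ ℓ x}
      ≤ ENNReal.ofReal (Real.exp (1 / (1 - δ)) * (1 / Nat.factorial i) *
          ((i * (1 - δ)) / k) ^ i)) ∧
    (Real.exp (1 / (1 - δ)) * (1 / Nat.factorial i) * ((i * (1 - δ)) / k) ^ i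
      ≤ Real.exp (1 / (1 - δ)) * (Real.exp 1 * (1 - δ) / k) ^ i) := by
  have hd : 0 < 1 - δ := by linarith
  have hk0 : (0 : ℝ) < k := by exact_mod_cast hk
  refine ⟨ENNReal.div_le_of_le_mul ?_, ?_⟩
  · let f : Fin i → TreeEdge D k := fun t => edgeOfLeaf D k y ⟨k - i + t, by omega⟩
    have hf : Function.Injective f := fun s t h => by
      have := congrArg Fin.val (edgeOfLeaf_injective D k y h)
      simp only at this
      omega
    have hfx (t : Fin i) (j : Fin k) : f t ≠ edgeOfLeaf D k x j := by
      intro h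
      obtain rfl : (⟨k - i + t, by omega⟩ : Fin k) = j := congrArg Sigma.fst h
      exact hdiff (edgeOfLeaf_eq_of_le (Nat.le_add_right _ _) h.symm)
    obtain ⟨A, hA, hAeq⟩ := exists_measurableSet_isGoodPath D k hk δ x
    set a : ℝ := ((k - i : ℝ) + 1) / k * (1 - δ - 1 / k)
    have hB := measurableSet_monotoneTuples i a (1 - δ)
    have hprob : cubeMeasure (TreeEdge D k)
        ((fun ℓ t => ℓ (f t)) ⁻¹' monotoneTuples i a (1 - δ)) ≤
        ENNReal.ofReal (Real.exp (1 / (1 - δ)) * (1 / Nat.factorial i) *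
          ((i * (1 - δ)) / k) ^ i) := by
      rw [← Measure.map_apply (measurable_pi_lambda _ fun t => measurable_pi_apply (f t)) hB,
        map_cubeMeasure_comp hf]
      refine (cubeMeasure_le_volume _ _).trans ((volume_monotoneTuples_le i a (1 - δ)).trans ?_)
      have hfac : (0 : ℝ) < i.factorial := by exact_mod_cast i.factorial_pos
      rw [mul_right_comm, mul_one_div, ENNReal.ofReal_div_of_pos hfac, ENNReal.ofReal_natCast]
      refine ENNReal.div_le_div_right ?_ _
      rcases le_total 0 (1 - δ - a) with hnn | hneg
      · rw [← ENNReal.ofReal_pow hnn]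
        exact ENNReal.ofReal_le_ofReal (interval_length_pow_le hi1 hik hδ1 hδk)
      · rw [ENNReal.ofReal_of_nonpos hneg, zero_pow (by omega)]
        exact zero_le
    calc cubeMeasure (TreeEdge D k)
          ({ℓ | IsGoodPath D k hk δ ℓ y} ∩ {ℓ | IsGoodPath D k hk δ ℓ x})
        ≤ cubeMeasure (TreeEdge D k) ((fun ℓ t => ℓ (f t)) ⁻¹' monotoneTuples i a (1 - δ) ∩
            (fun ℓ j => ℓ (edgeOfLeaf D k x j)) ⁻¹' A) := by
          rw [hAeq]
          exact measure_mono (Set.inter_subset_inter_left _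
            fun ℓ hℓ => IsGoodPath.tail_mem_monotoneTuples (hk := hk) hℓ hi1 hik)
      _ = cubeMeasure (TreeEdge D k) ((fun ℓ t => ℓ (f t)) ⁻¹' monotoneTuples i a (1 - δ)) *
            cubeMeasure (TreeEdge D k) {ℓ | IsGoodPath D k hk δ ℓ x} := by
          rw [hAeq]
          exact (indepFun_cubeMeasure_comp hfx).measure_inter_preimage_eq_mul _ _ hB hA
      _ ≤ _ := by gcongr
  · rw [mul_assoc, mul_div_assoc, mul_div_assoc]
    exact mul_le_mul_of_nonneg_left (one_div_factorial_mul_pow_le i (by positivity))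
      (Real.exp_pos _).le
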